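/- arXiv:1709.00625 — 3 statements merged into one kernel-verified Lean document; each statement's English description precedes it below -/
import Mathlib

section
/- Let x ≥ 1 and consider the bicameral game with m_s = 2x + 1, m_r = 4x + 2 (so m_r = 2·m_s) and simple-majority quotas q_s = x + 1, q_r = 2x + 2. Then: (a) c_s(k) ≠ 0 for all k with 3x + 3 ≤ k ≤ 5x + 3; (b) c_s(3x + 3) = c_r(3x + 3); (c) c_s(k) > c_r(k) for all k with 3x + 4 ≤ k ≤ 5x + 3. -/
/-- A coalition in the bicameral game with `ms` senators (the left summands) and `mr`
representatives (the right summands) is winning iff it contains at least `qs` senators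
and at least `qr` representatives. -/
def bicamWinning (ms mr qs qr : ℕ) (S : Finset (Fin ms ⊕ Fin mr)) : Prop :=
  qs ≤ (S.filter (fun p => p.isLeft)).card ∧ qr ≤ (S.filter (fun p => p.isRight)).card

/-- The number of coalitions of size `k` in which player `i` is critical in the
bicameral game with parameters `(ms, mr, qs, qr)`. -/
noncomputable def bicamCrit (ms mr qs qr : ℕ) (i : Fin ms ⊕ Fin mr) (k : ℕ) : ℕ :=
  Set.ncard {S : Finset (Fin ms ⊕ Fin mr) |
    S.card = k ∧ i ∈ S ∧ bicamWinning ms mr qs qr S ∧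
      ¬ bicamWinning ms mr qs qr (S.erase i)}

/-- A subset of a disjoint union amounts to an independent choice of its two parts. -/
lemma ncard_setOf_toLeft_mem_and_toRight_mem {α β : Type*}
    (P : Set (Finset α)) (Q : Set (Finset β)) :
    Set.ncard {S : Finset (α ⊕ β) | S.toLeft ∈ P ∧ S.toRight ∈ Q} = P.ncard * Q.ncard := by
  rw [← Set.ncard_prod]
  refine Set.ncard_congr (fun S _ => (S.toLeft, S.toRight)) (fun S hS => hS) ?_ ?_
  · intro S T _ _ h
    rw [Prod.mk.injEq] at h
    rw [← S.toLeft_disjSum_toRight, ← T.toLeft_disjSum_toRight, h.1, h.2]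
  · rintro ⟨A, B⟩ hAB
    exact ⟨A.disjSum B, by simpa using hAB, by simp⟩

lemma ncard_finset_card_eq (n b : ℕ) :
    Set.ncard {B : Finset (Fin n) | B.card = b} = n.choose b := by
  have h : {B : Finset (Fin n) | B.card = b} =
      (Finset.powersetCard b (Finset.univ : Finset (Fin n)) : Set (Finset (Fin n))) := by
    ext B; simp [Finset.mem_powersetCard]
  rw [h, Set.ncard_coe_finset, Finset.card_powersetCard, Finset.card_fin]

lemma ncard_finset_mem_card_eq {n : ℕ} (i : Fin (n + 1)) (a : ℕ) :
    Set.ncard {A : Finset (Fin (n + 1)) | i ∈ A ∧ A.card = a + 1} = n.choose a := by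
  have h : n.choose a = ((Finset.powersetCard a (Finset.univ.erase i) :
      Finset (Finset (Fin (n + 1)))) : Set (Finset (Fin (n + 1)))).ncard := by
    rw [Set.ncard_coe_finset, Finset.card_powersetCard, Finset.card_erase_of_mem (by simp),
      Finset.card_fin, Nat.add_sub_cancel]
  rw [h]
  refine Set.ncard_congr (fun A _ => A.erase i) ?_ ?_ ?_
  · rintro A ⟨hi, hA⟩
    simp [Finset.mem_powersetCard, Finset.card_erase_of_mem hi, hA, Finset.erase_subset_erase]
  · rintro A B ⟨hA, _⟩ ⟨hB, _⟩ hAB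
    rw [← Finset.insert_erase hA, ← Finset.insert_erase hB, hAB]
  · intro B hB
    rw [Finset.mem_coe, Finset.mem_powersetCard] at hB
    have hi : i ∉ B := fun h => by simpa using hB.1 h
    exact ⟨insert i B, by simp [hi, hB.2], by simp [hi]⟩

lemma bicamWinning_iff (ms mr qs qr : ℕ) (S : Finset (Fin ms ⊕ Fin mr)) :
    bicamWinning ms mr qs qr S ↔ qs ≤ S.toLeft.card ∧ qr ≤ S.toRight.card := by
  have hl : S.filter (fun p => p.isLeft) = S.toLeft.map Function.Embedding.inl := by
    ext (a | b) <;> simp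
  have hr : S.filter (fun p => p.isRight) = S.toRight.map Function.Embedding.inr := by
    ext (a | b) <;> simp
  rw [bicamWinning, hl, hr, Finset.card_map, Finset.card_map]

lemma toLeft_erase_inl {α β : Type*} [DecidableEq α] [DecidableEq β]
    (S : Finset (α ⊕ β)) (a : α) : (S.erase (Sum.inl a)).toLeft = S.toLeft.erase a := by
  ext; simp

lemma toRight_erase_inl {α β : Type*} [DecidableEq α] [DecidableEq β]
    (S : Finset (α ⊕ β)) (a : α) : (S.erase (Sum.inl a)).toRight = S.toRight := by
  ext; simp

lemma toLeft_erase_inr {α β : Type*} [DecidableEq α] [DecidableEq β]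
    (S : Finset (α ⊕ β)) (b : β) : (S.erase (Sum.inr b)).toLeft = S.toLeft := by
  ext; simp

lemma toRight_erase_inr {α β : Type*} [DecidableEq α] [DecidableEq β]
    (S : Finset (α ⊕ β)) (b : β) : (S.erase (Sum.inr b)).toRight = S.toRight.erase b := by
  ext; simp

/-- A senator is critical exactly when the senate quota is met tightly. -/
lemma bicamCrit_inl {m mr q qr b : ℕ} (s : Fin (m + 1)) (hb : qr ≤ b) :
    bicamCrit (m + 1) mr (q + 1) qr (Sum.inl s) (q + 1 + b) = m.choose q * mr.choose b := by
  rw [← ncard_finset_mem_card_eq s q, ← ncard_finset_card_eq mr b,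
    ← ncard_setOf_toLeft_mem_and_toRight_mem, bicamCrit]
  congr 1
  ext S
  have hS := S.card_toLeft_add_card_toRight
  simp only [Set.mem_ofPred_eq, bicamWinning_iff, toLeft_erase_inl, toRight_erase_inl,
    ← Finset.mem_toLeft]
  by_cases hs : s ∈ S.toLeft
  · rw [Finset.card_erase_of_mem hs]
    simp only [hs, true_and]
    omega
  · simp [hs]

/-- A representative is critical exactly when the house quota is met tightly. -/
lemma bicamCrit_inr {ms m qs q a : ℕ} (r : Fin (m + 1)) (ha : qs ≤ a) :
    bicamCrit ms (m + 1) qs (q + 1) (Sum.inr r) (a + (q + 1)) = ms.choose a * m.choose q := by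
  rw [← ncard_finset_mem_card_eq r q, ← ncard_finset_card_eq ms a,
    ← ncard_setOf_toLeft_mem_and_toRight_mem, bicamCrit]
  congr 1
  ext S
  have hS := S.card_toLeft_add_card_toRight
  simp only [Set.mem_ofPred_eq, bicamWinning_iff, toLeft_erase_inr, toRight_erase_inr,
    ← Finset.mem_toRight]
  by_cases hr : r ∈ S.toRight
  · rw [Finset.card_erase_of_mem hr]
    simp only [hr, true_and]
    omega
  · simp [hr]

lemma choose_mul_choose_double_eq (x : ℕ) :
    (2 * x).choose x * (4 * x + 2).choose (2 * x + 2) =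
      (2 * x + 1).choose (x + 1) * (4 * x + 1).choose (2 * x + 1) := by
  have h₁ := Nat.add_one_mul_choose_eq (2 * x) x
  have h₂ := Nat.add_one_mul_choose_eq (4 * x + 1) (2 * x + 1)
  refine Nat.eq_of_mul_eq_mul_left (Nat.succ_pos (2 * x + 1)) ?_
  grind

lemma choose_mul_choose_double_step {x j : ℕ} (hj : j < 2 * x)
    (h : (2 * x + 1).choose (x + 1 + j) * (4 * x + 1).choose (2 * x + 1) ≤
      (2 * x).choose x * (4 * x + 2).choose (2 * x + 2 + j)) :
    (2 * x + 1).choose (x + 1 + (j + 1)) * (4 * x + 1).choose (2 * x + 1) <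
      (2 * x).choose x * (4 * x + 2).choose (2 * x + 2 + (j + 1)) := by
  have hc : 0 < (2 * x).choose x := Nat.choose_pos (by omega)
  rcases le_or_gt x j with hxj | hxj
  · rw [Nat.choose_eq_zero_of_lt (show 2 * x + 1 < x + 1 + (j + 1) by omega), zero_mul]
    exact Nat.mul_pos hc (Nat.choose_pos (by omega))
  · have hL := Nat.choose_succ_right_eq (4 * x + 2) (2 * x + 2 + j)
    have hR := Nat.choose_succ_right_eq (2 * x + 1) (x + 1 + j)
    have hpos : 0 < (2 * x).choose x * (4 * x + 2).choose (2 * x + 2 + j) :=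
      Nat.mul_pos hc (Nat.choose_pos (by omega))
    obtain ⟨d, rfl⟩ := Nat.exists_eq_add_of_lt hxj
    rw [show 4 * (j + d + 1) + 2 - (2 * (j + d + 1) + 2 + j) = j + 2 * d + 2 by omega] at hL
    rw [show 2 * (j + d + 1) + 1 - (j + d + 1 + 1 + j) = d + 1 by omega] at hR
    simp only [← add_assoc] at hL hR h hpos ⊢
    generalize (2 * (j + d + 1)).choose (j + d + 1) = c at *
    generalize (4 * (j + d + 1) + 1).choose _ = e at *
    generalize (4 * (j + d + 1) + 2).choose (2 * (j + d + 1) + 2 + j) = L at *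
    generalize (4 * (j + d + 1) + 2).choose _ = L' at *
    generalize (2 * (j + d + 1) + 1).choose (j + d + 1 + 1 + j) = R at *
    generalize (2 * (j + d + 1) + 1).choose _ = R' at *
    refine Nat.lt_of_mul_lt_mul_right
      (a := (2 * (j + d + 1) + 2 + j + 1) * (j + d + 1 + 1 + j + 1)) ?_
    calc R' * e * ((2 * (j + d + 1) + 2 + j + 1) * (j + d + 1 + 1 + j + 1))
        = R * e * ((d + 1) * (2 * (j + d + 1) + 2 + j + 1)) := by
          linear_combination e * (2 * (j + d + 1) + 2 + j + 1) * hR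
      _ ≤ c * L * ((d + 1) * (2 * (j + d + 1) + 2 + j + 1)) := Nat.mul_le_mul_right _ h
      _ < c * L * ((j + 2 * d + 2) * (j + d + 1 + 1 + j + 1)) :=
          Nat.mul_lt_mul_of_pos_left (by nlinarith) hpos
      _ = c * L' * ((2 * (j + d + 1) + 2 + j + 1) * (j + d + 1 + 1 + j + 1)) := by
          linear_combination c * (j + d + 1 + 1 + j + 1) * hL.symm

lemma choose_mul_choose_double_lt {x j : ℕ} (hj : j < 2 * x) :
    (2 * x + 1).choose (x + 1 + (j + 1)) * (4 * x + 1).choose (2 * x + 1) <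
      (2 * x).choose x * (4 * x + 2).choose (2 * x + 2 + (j + 1)) := by
  induction j with
  | zero => exact choose_mul_choose_double_step hj (choose_mul_choose_double_eq x).ge
  | succ j ih => exact choose_mul_choose_double_step hj (ih (by omega)).le

/-- The extreme exceptional case `mr = 2 * ms`: with `ms = 2x + 1`, `mr = 4x + 2`,
`qs = x + 1`, `qr = 2x + 2`: (a) the senator's critical numbers are nonzero for
`3x + 3 ≤ k ≤ 5x + 3`; (b) equality at `k = 3x + 3`; (c) strict dominance of the
senator for `3x + 4 ≤ k ≤ 5x + 3`. -/
theorem bicam_double_size_case (x : ℕ) (hx : 1 ≤ x)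
    (s : Fin (2 * x + 1)) (r : Fin (4 * x + 2)) :
    (∀ k : ℕ, 3 * x + 3 ≤ k → k ≤ 5 * x + 3 →
      bicamCrit (2 * x + 1) (4 * x + 2) (x + 1) (2 * x + 2) (Sum.inl s) k ≠ 0) ∧
    (bicamCrit (2 * x + 1) (4 * x + 2) (x + 1) (2 * x + 2) (Sum.inl s) (3 * x + 3) =
     bicamCrit (2 * x + 1) (4 * x + 2) (x + 1) (2 * x + 2) (Sum.inr r) (3 * x + 3)) ∧
    (∀ k : ℕ, 3 * x + 4 ≤ k → k ≤ 5 * x + 3 →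
      bicamCrit (2 * x + 1) (4 * x + 2) (x + 1) (2 * x + 2) (Sum.inl s) k >
      bicamCrit (2 * x + 1) (4 * x + 2) (x + 1) (2 * x + 2) (Sum.inr r) k) := by
  have hs (j : ℕ) : bicamCrit (2 * x + 1) (4 * x + 2) (x + 1) (2 * x + 2) (Sum.inl s)
      (3 * x + 3 + j) = (2 * x).choose x * (4 * x + 2).choose (2 * x + 2 + j) := by
    rw [← bicamCrit_inl s (Nat.le_add_right (2 * x + 2) j)]
    congr 1
    ring
  have hr (j : ℕ) : bicamCrit (2 * x + 1) (4 * x + 2) (x + 1) (2 * x + 2) (Sum.inr r)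
      (3 * x + 3 + j) = (2 * x + 1).choose (x + 1 + j) * (4 * x + 1).choose (2 * x + 1) := by
    rw [← bicamCrit_inr r (Nat.le_add_right (x + 1) j)]
    congr 1
    ring
  refine ⟨fun k hk hk' => ?_, ?_, fun k hk hk' => ?_⟩
  · obtain ⟨j, rfl⟩ := Nat.exists_eq_add_of_le hk
    rw [hs]
    exact (Nat.mul_pos (Nat.choose_pos (by omega)) (Nat.choose_pos (by omega))).ne'
  · exact (hs 0).trans ((choose_mul_choose_double_eq x).trans (hr 0).symm)
  · obtain ⟨j, rfl⟩ := Nat.exists_eq_add_of_le hk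
    rw [show 3 * x + 4 + j = 3 * x + 3 + (j + 1) by ring, hs, hr]
    exact choose_mul_choose_double_lt (by omega)
end

section
/- In the US legislative game: for every k, if c_s(k) = 0 then c_r(k) = 0; and for every k with c_s(k) ≠ 0, c_s(k) > c_r(k). -/
/-- The players of the US legislative game: the president, the vice president,
100 senators, and 435 representatives. -/
inductive USPlayer where
  | pres : USPlayer
  | vp : USPlayer
  | sen : Fin 100 → USPlayer
  | rep : Fin 435 → USPlayer
  deriving DecidableEq

/-- Whether a player is a senator. -/
def USPlayer.isSen : USPlayer → Bool
  | .sen _ => true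
  | _ => false

/-- Whether a player is a representative. -/
def USPlayer.isRep : USPlayer → Bool
  | .rep _ => true
  | _ => false

/-- The number of senators in a coalition. -/
def numSen (S : Finset USPlayer) : ℕ := (S.filter (fun p => p.isSen)).card

/-- The number of representatives in a coalition. -/
def numRep (S : Finset USPlayer) : ℕ := (S.filter (fun p => p.isRep)).card

/-- A coalition is winning in the US legislative game iff either the president is in it
together with at least 218 representatives and either at least 51 senators or the vice
president and at least 50 senators; or it contains at least 67 senators and at least
290 representatives (veto override). -/
def usWinning (S : Finset USPlayer) : Prop :=
  (USPlayer.pres ∈ S ∧ 218 ≤ numRep S ∧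
    (51 ≤ numSen S ∨ (USPlayer.vp ∈ S ∧ 50 ≤ numSen S))) ∨
  (67 ≤ numSen S ∧ 290 ≤ numRep S)

/-- The number of coalitions of size `k` in which player `i` is critical in the US
legislative game. -/
noncomputable def usCrit (i : USPlayer) (k : ℕ) : ℕ :=
  Set.ncard {S : Finset USPlayer |
    S.card = k ∧ i ∈ S ∧ usWinning S ∧ ¬ usWinning (S.erase i)}

/-- The coalition with prescribed membership of the president and the vice president, and
prescribed sets of senators and representatives. -/
def coalition (x : Bool × Bool) (y : Finset (Fin 100) × Finset (Fin 435)) : Finset USPlayer :=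
  ((if x.1 then {USPlayer.pres} else ∅) ∪ (if x.2 then {USPlayer.vp} else ∅)) ∪
    (y.1.image USPlayer.sen ∪ y.2.image USPlayer.rep)

section coalition

variable (x : Bool × Bool) (y : Finset (Fin 100) × Finset (Fin 435))

@[simp] lemma pres_mem_coalition : USPlayer.pres ∈ coalition x y ↔ x.1 = true := by
  rcases x with ⟨_ | _, _ | _⟩ <;> simp [coalition]

@[simp] lemma vp_mem_coalition : USPlayer.vp ∈ coalition x y ↔ x.2 = true := by
  rcases x with ⟨_ | _, _ | _⟩ <;> simp [coalition]

@[simp] lemma sen_mem_coalition (s : Fin 100) : USPlayer.sen s ∈ coalition x y ↔ s ∈ y.1 := by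
  rcases x with ⟨_ | _, _ | _⟩ <;> simp [coalition]

@[simp] lemma rep_mem_coalition (r : Fin 435) : USPlayer.rep r ∈ coalition x y ↔ r ∈ y.2 := by
  rcases x with ⟨_ | _, _ | _⟩ <;> simp [coalition]

lemma numSen_coalition : numSen (coalition x y) = y.1.card := by
  rw [numSen, ← Finset.card_image_of_injective y.1
    (f := USPlayer.sen) (fun _ _ h => USPlayer.sen.inj h)]
  congr 1
  ext (_ | _ | _ | _) <;> rw [Finset.mem_filter] <;> simp [USPlayer.isSen]

lemma numRep_coalition : numRep (coalition x y) = y.2.card := by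
  rw [numRep, ← Finset.card_image_of_injective y.2
    (f := USPlayer.rep) (fun _ _ h => USPlayer.rep.inj h)]
  congr 1
  ext (_ | _ | _ | _) <;> rw [Finset.mem_filter] <;> simp [USPlayer.isRep]

lemma card_coalition :
    (coalition x y).card = x.1.toNat + x.2.toNat + (y.1.card + y.2.card) := by
  have h₁ := Finset.card_image_of_injective y.1
    (f := USPlayer.sen) (fun _ _ h => USPlayer.sen.inj h)
  have h₂ := Finset.card_image_of_injective y.2
    (f := USPlayer.rep) (fun _ _ h => USPlayer.rep.inj h)
  rw [coalition, Finset.card_union_of_disjoint, Finset.card_union_of_disjoint,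
    Finset.card_union_of_disjoint, h₁, h₂]
  · rcases x with ⟨_ | _, _ | _⟩ <;> simp
  · simp [Finset.disjoint_left]
  · rcases x with ⟨_ | _, _ | _⟩ <;> simp
  · rcases x with ⟨_ | _, _ | _⟩ <;> simp [Finset.disjoint_left]

lemma coalition_erase_sen (s : Fin 100) :
    (coalition x y).erase (USPlayer.sen s) = coalition x (y.1.erase s, y.2) := by
  ext (_ | _ | _ | _) <;> simp

lemma coalition_erase_rep (r : Fin 435) :
    (coalition x y).erase (USPlayer.rep r) = coalition x (y.1, y.2.erase r) := by
  ext (_ | _ | _ | _) <;> simp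

lemma usWinning_coalition : usWinning (coalition x y) ↔
    (x.1 = true ∧ 218 ≤ y.2.card ∧ (51 ≤ y.1.card ∨ (x.2 = true ∧ 50 ≤ y.1.card))) ∨
      (67 ≤ y.1.card ∧ 290 ≤ y.2.card) := by
  simp [usWinning, numSen_coalition, numRep_coalition]

end coalition

lemma coalition_injective {x x' : Bool × Bool} {y y' : Finset (Fin 100) × Finset (Fin 435)}
    (h : coalition x y = coalition x' y') : x = x' ∧ y = y' := by
  have key := fun i => (Finset.ext_iff.mp h) i
  refine ⟨Prod.ext ?_ ?_, Prod.ext ?_ ?_⟩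
  · exact Bool.eq_iff_iff.mpr (by simpa using key USPlayer.pres)
  · exact Bool.eq_iff_iff.mpr (by simpa using key USPlayer.vp)
  · ext s
    simpa using key (USPlayer.sen s)
  · ext r
    simpa using key (USPlayer.rep r)

lemma exists_coalition_eq (S : Finset USPlayer) : ∃ x y, coalition x y = S := by
  classical
  refine ⟨(decide (USPlayer.pres ∈ S), decide (USPlayer.vp ∈ S)),
    (Finset.univ.filter fun s => USPlayer.sen s ∈ S,
      Finset.univ.filter fun r => USPlayer.rep r ∈ S), ?_⟩
  ext (_ | _ | _ | _) <;> simp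

lemma ncard_setOf_coalition (p : Finset USPlayer → Prop) :
    {S | p S}.ncard = ∑ x : Bool × Bool, {y | p (coalition x y)}.ncard := by
  simp only [← Nat.card_coe_set_eq]
  rw [← Nat.card_sigma]
  symm
  refine Nat.card_congr (Equiv.ofBijective
    (fun z => ⟨coalition z.1 z.2.1, z.2.2⟩ :
      (Σ x : Bool × Bool, ({y | p (coalition x y)} : Set _)) → ({S | p S} : Set _)) ⟨?_, ?_⟩)
  · rintro ⟨x, y, hy⟩ ⟨x', y', hy'⟩ h
    obtain ⟨rfl, rfl⟩ := coalition_injective (Subtype.ext_iff.mp h)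
    rfl
  · rintro ⟨S, hS⟩
    obtain ⟨x, y, rfl⟩ := exists_coalition_eq S
    exact ⟨⟨x, y, hS⟩, rfl⟩

/-- The pairs of senate and house parts making a senator critical, given which executives
take part. -/
def senCritParts (s : Fin 100) (k : ℕ) (x : Bool × Bool) :
    Set (Finset (Fin 100) × Finset (Fin 435)) :=
  {y | (coalition x y).card = k ∧ USPlayer.sen s ∈ coalition x y ∧ usWinning (coalition x y) ∧
    ¬ usWinning ((coalition x y).erase (USPlayer.sen s))}

/-- The pairs of senate and house parts making a representative critical, given which
executives take part. -/
def repCritParts (r : Fin 435) (k : ℕ) (x : Bool × Bool) :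
    Set (Finset (Fin 100) × Finset (Fin 435)) :=
  {y | (coalition x y).card = k ∧ USPlayer.rep r ∈ coalition x y ∧ usWinning (coalition x y) ∧
    ¬ usWinning ((coalition x y).erase (USPlayer.rep r))}

lemma usCrit_sen (s : Fin 100) (k : ℕ) :
    usCrit (USPlayer.sen s) k = ∑ x, (senCritParts s k x).ncard :=
  ncard_setOf_coalition _

lemma usCrit_rep (r : Fin 435) (k : ℕ) :
    usCrit (USPlayer.rep r) k = ∑ x, (repCritParts r k x).ncard :=
  ncard_setOf_coalition _

lemma mem_senCritParts {s : Fin 100} {k : ℕ} {x : Bool × Bool}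
    {y : Finset (Fin 100) × Finset (Fin 435)} :
    y ∈ senCritParts s k x ↔ s ∈ y.1 ∧ x.1.toNat + x.2.toNat + (y.1.card + y.2.card) = k ∧
      ((x.1 = true ∧ y.1.card = (if x.2 then 50 else 51) ∧ 218 ≤ y.2.card) ∨
        (x.1 = false ∧ y.1.card = 67 ∧ 290 ≤ y.2.card)) := by
  rw [senCritParts, Set.mem_ofPred_eq, sen_mem_coalition, card_coalition, coalition_erase_sen,
    usWinning_coalition, usWinning_coalition]
  by_cases hs : s ∈ y.1
  · have := Finset.card_pos.mpr ⟨s, hs⟩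
    rcases x with ⟨_ | _, _ | _⟩ <;> simp [hs] <;> omega
  · simp [hs]

lemma mem_repCritParts {r : Fin 435} {k : ℕ} {x : Bool × Bool}
    {y : Finset (Fin 100) × Finset (Fin 435)} :
    y ∈ repCritParts r k x ↔ r ∈ y.2 ∧ x.1.toNat + x.2.toNat + (y.1.card + y.2.card) = k ∧
      ((x.1 = true ∧ y.2.card = 218 ∧ (if x.2 then 50 else 51) ≤ y.1.card) ∨
        (x.1 = false ∧ y.2.card = 290 ∧ 67 ≤ y.1.card)) := by
  rw [repCritParts, Set.mem_ofPred_eq, rep_mem_coalition, card_coalition, coalition_erase_rep,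
    usWinning_coalition, usWinning_coalition]
  by_cases hr : r ∈ y.2
  · have := Finset.card_pos.mpr ⟨r, hr⟩
    rcases x with ⟨_ | _, _ | _⟩ <;> simp [hr] <;> omega
  · simp [hr]

lemma card_filter_mem_powersetCard_succ {α : Type*} [Fintype α] [DecidableEq α] (i : α) (n : ℕ) :
    ((Finset.univ.powersetCard (n + 1)).filter fun A : Finset α => i ∈ A).card =
      (Fintype.card α - 1).choose n := by
  rw [← Finset.card_univ, ← Finset.card_erase_of_mem (Finset.mem_univ i),
    ← Finset.card_powersetCard]
  refine Finset.card_bij' (fun A _ => A.erase i) (fun A _ => insert i A) ?_ ?_ ?_ ?_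
  · intro A hA
    simp only [Finset.mem_filter, Finset.mem_powersetCard] at hA ⊢
    refine ⟨Finset.erase_subset_erase _ hA.1.1, ?_⟩
    rw [Finset.card_erase_of_mem hA.2, hA.1.2, Nat.add_sub_cancel]
  · intro A hA
    simp only [Finset.mem_filter, Finset.mem_powersetCard, Finset.subset_erase] at hA ⊢
    simp [Finset.card_insert_of_notMem hA.1.2, hA.2]
  · intro A hA
    exact Finset.insert_erase (Finset.mem_filter.mp hA).2
  · intro A hA
    simp only [Finset.mem_powersetCard, Finset.subset_erase] at hA
    exact Finset.erase_insert hA.1.2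

lemma ncard_setOf_mem_fst {α β : Type*} [Fintype α] [Fintype β] (i : α) (a b : ℕ) :
    {y : Finset α × Finset β | i ∈ y.1 ∧ y.1.card = a + 1 ∧ y.2.card = b}.ncard =
      (Fintype.card α - 1).choose a * (Fintype.card β).choose b := by
  classical
  rw [← card_filter_mem_powersetCard_succ i, ← Finset.card_univ (α := β),
    ← Finset.card_powersetCard, ← Finset.card_product, ← Set.ncard_coe_finset]
  congr 1
  ext y
  simp [Finset.mem_powersetCard, and_comm, and_left_comm]

lemma ncard_setOf_mem_snd {α β : Type*} [Fintype α] [Fintype β] (i : β) (a b : ℕ) :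
    {y : Finset α × Finset β | i ∈ y.2 ∧ y.2.card = b + 1 ∧ y.1.card = a}.ncard =
      (Fintype.card β - 1).choose b * (Fintype.card α).choose a := by
  rw [← ncard_setOf_mem_fst i, ← Set.ncard_image_of_injective _ Prod.swap_injective]
  congr 1
  ext y
  simp [Set.image_swap_eq_preimage_swap]

lemma choose_mul_choose_lt {n a N b : ℕ} (hlt : (n + 1) * (b + 1) < (N + 1) * (a + 1))
    (hn : n ≤ N) (ha : a ≤ n) (hab : n + b ≤ N + a) (j : ℕ) (hj : b + j ≤ N) :
    N.choose b * (n + 1).choose (a + 1 + j) < n.choose a * (N + 1).choose (b + 1 + j) := by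
  have hpos : 0 < n.choose a := Nat.choose_pos ha
  induction j with
  | zero =>
    have h₁ := Nat.add_one_mul_choose_eq n a
    have h₂ := Nat.add_one_mul_choose_eq N b
    have hpos' : 0 < n.choose a * N.choose b := Nat.mul_pos hpos (Nat.choose_pos hj)
    refine Nat.lt_of_mul_lt_mul_right (a := (a + 1) * (b + 1)) ?_
    calc N.choose b * (n + 1).choose (a + 1) * ((a + 1) * (b + 1))
        = N.choose b * ((n + 1).choose (a + 1) * (a + 1)) * (b + 1) := by ring
      _ = (n + 1) * (b + 1) * (n.choose a * N.choose b) := by rw [← h₁]; ring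
      _ < (N + 1) * (a + 1) * (n.choose a * N.choose b) := Nat.mul_lt_mul_of_pos_right hlt hpos'
      _ = n.choose a * ((N + 1).choose (b + 1) * (b + 1)) * (a + 1) := by rw [← h₂]; ring
      _ = n.choose a * (N + 1).choose (b + 1) * ((a + 1) * (b + 1)) := by ring
  | succ j ih =>
    obtain ⟨v, rfl⟩ := Nat.exists_eq_add_of_le (show b + j ≤ N by omega)
    rcases Nat.lt_or_ge n (a + j + 1) with hnj | hnj
    · rw [Nat.choose_eq_zero_of_lt (show n + 1 < a + 1 + (j + 1) by omega), mul_zero]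
      exact Nat.mul_pos hpos (Nat.choose_pos (by omega))
    · obtain ⟨u, rfl⟩ := Nat.exists_eq_add_of_le (show a + j ≤ n by omega)
      have h₁ := Nat.choose_succ_right_eq (a + j + u + 1) (a + 1 + j)
      have h₂ := Nat.choose_succ_right_eq (b + j + v + 1) (b + 1 + j)
      rw [show a + j + u + 1 - (a + 1 + j) = u by omega] at h₁
      rw [show b + j + v + 1 - (b + 1 + j) = v by omega] at h₂
      have huv : u * (b + 1 + j + 1) ≤ v * (a + 1 + j + 1) := by
        have := Nat.mul_le_mul_left j hn
        nlinarith
      have hv : 0 < v * (a + 1 + j + 1) := Nat.mul_pos (by omega) (by omega)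
      have ih := ih (by omega)
      rw [← add_assoc, ← add_assoc]
      set P := (a + j + u + 1).choose (a + 1 + j)
      set Q := (b + j + v + 1).choose (b + 1 + j)
      set P' := (a + j + u + 1).choose (a + 1 + j + 1)
      set Q' := (b + j + v + 1).choose (b + 1 + j + 1)
      set c := (b + j + v).choose b
      set d := (a + j + u).choose a
      refine Nat.lt_of_mul_lt_mul_right (a := (a + 1 + j + 1) * (b + 1 + j + 1)) ?_
      calc c * P' * ((a + 1 + j + 1) * (b + 1 + j + 1))
          = c * (P' * (a + 1 + j + 1)) * (b + 1 + j + 1) := by ring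
        _ = c * P * (u * (b + 1 + j + 1)) := by rw [h₁]; ring
        _ ≤ c * P * (v * (a + 1 + j + 1)) := Nat.mul_le_mul_left _ huv
        _ < d * Q * (v * (a + 1 + j + 1)) := Nat.mul_lt_mul_of_pos_right ih hv
        _ = d * (Q' * (b + 1 + j + 1)) * (a + 1 + j + 1) := by rw [h₂]; ring
        _ = d * Q' * ((a + 1 + j + 1) * (b + 1 + j + 1)) := by ring

lemma ncard_senCritParts_eq {s : Fin 100} {k a b : ℕ} {x : Bool × Bool}
    (h : ∀ y : Finset (Fin 100) × Finset (Fin 435), y ∈ senCritParts s k x ↔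
      s ∈ y.1 ∧ y.1.card = a + 1 ∧ y.2.card = b) :
    (senCritParts s k x).ncard = Nat.choose 99 a * Nat.choose 435 b := by
  have := ncard_setOf_mem_fst (β := Fin 435) s a b
  rw [Fintype.card_fin, Fintype.card_fin] at this
  rw [← this]
  exact congrArg Set.ncard (Set.ext h)

lemma ncard_repCritParts_eq {r : Fin 435} {k a b : ℕ} {x : Bool × Bool}
    (h : ∀ y : Finset (Fin 100) × Finset (Fin 435), y ∈ repCritParts r k x ↔
      r ∈ y.2 ∧ y.2.card = b + 1 ∧ y.1.card = a) :
    (repCritParts r k x).ncard = Nat.choose 434 b * Nat.choose 100 a := by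
  have := ncard_setOf_mem_snd (α := Fin 100) r a b
  rw [Fintype.card_fin, Fintype.card_fin] at this
  rw [← this]
  exact congrArg Set.ncard (Set.ext h)

lemma ncard_repCritParts_pres_lt (s : Fin 100) (r : Fin 435) {j : ℕ} (hj : j ≤ 217) :
    (repCritParts r (270 + j) (true, true)).ncard +
        (repCritParts r (270 + j) (true, false)).ncard <
      (senCritParts s (270 + j) (true, true)).ncard +
        (senCritParts s (270 + j) (true, false)).ncard := by
  rw [ncard_repCritParts_eq (a := 50 + j) (b := 217),
    ncard_repCritParts_eq (a := 51 + j) (b := 217),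
    ncard_senCritParts_eq (a := 49) (b := 218 + j), ncard_senCritParts_eq (a := 50) (b := 218 + j),
    ← mul_add, ← add_mul]
  · have h := choose_mul_choose_lt (n := 100) (a := 50) (N := 434) (b := 217) (by norm_num)
      (by norm_num) (by norm_num) (by norm_num) j (by omega)
    have h₁ := Nat.choose_succ_succ' 99 49
    have h₂ := Nat.choose_succ_succ' 100 (50 + j)
    rw [show 50 + j + 1 = 51 + j by omega] at h₂
    rw [← h₁, ← h₂]
    exact h
  all_goals
    intro y
    first | rw [mem_senCritParts] | rw [mem_repCritParts]
    simp only [Bool.toNat_true, Bool.toNat_false, if_true, Bool.false_eq_true, if_false,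
      Bool.true_eq_false, true_and, false_and, or_false]
    refine and_congr_right fun _ => ?_
    omega

lemma ncard_repCritParts_no_pres_le (s : Fin 100) (r : Fin 435) (k : ℕ) (v : Bool) :
    (repCritParts r k (false, v)).ncard ≤ (senCritParts s k (false, v)).ncard := by
  by_cases hk : 357 + v.toNat ≤ k ∧ k ≤ 502 + v.toNat
  · obtain ⟨i, rfl⟩ := Nat.exists_eq_add_of_le hk.1
    rw [ncard_repCritParts_eq (a := 67 + i) (b := 289),
      ncard_senCritParts_eq (a := 66) (b := 290 + i)]
    · exact (choose_mul_choose_lt (n := 99) (a := 66) (N := 434) (b := 289) (by norm_num)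
        (by norm_num) (by norm_num) (by norm_num) i (by omega)).le
    all_goals
      intro y
      first | rw [mem_senCritParts] | rw [mem_repCritParts]
      simp only [Bool.toNat_false, Bool.false_eq_true, true_and, false_and, false_or]
      refine and_congr_right fun _ => ?_
      omega
  · have : repCritParts r k (false, v) = ∅ := by
      refine Set.eq_empty_of_forall_notMem fun y hy => hk ?_
      have hA : y.1.card ≤ 100 := by simpa using Finset.card_le_univ y.1
      simp only [mem_repCritParts, Bool.toNat_false, Bool.false_eq_true, true_and, false_and,
        false_or] at hy
      omega
    simp [this]

lemma le_and_le_of_usCrit_rep_ne_zero {r : Fin 435} {k : ℕ}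
    (h : usCrit (USPlayer.rep r) k ≠ 0) : 270 ≤ k ∧ k ≤ 487 := by
  rw [usCrit_rep] at h
  obtain ⟨⟨p, v⟩, -, hx⟩ := Finset.exists_ne_zero_of_sum_ne_zero h
  obtain ⟨y, hy⟩ := Set.nonempty_of_ncard_ne_zero hx
  have hA : y.1.card ≤ 100 := by simpa using Finset.card_le_univ y.1
  rw [mem_repCritParts] at hy
  rcases p <;> rcases v <;> simp at hy <;> omega

lemma usCrit_rep_lt_usCrit_sen {s : Fin 100} {r : Fin 435} {k : ℕ}
    (h : usCrit (USPlayer.rep r) k ≠ 0) :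
    usCrit (USPlayer.rep r) k < usCrit (USPlayer.sen s) k := by
  obtain ⟨h₁, h₂⟩ := le_and_le_of_usCrit_rep_ne_zero h
  obtain ⟨j, rfl⟩ := Nat.exists_eq_add_of_le h₁
  rw [usCrit_rep, usCrit_sen]
  simp only [Fintype.sum_prod_type, Fintype.sum_bool]
  exact add_lt_add_of_lt_of_le (ncard_repCritParts_pres_lt s r (by omega))
    (add_le_add (ncard_repCritParts_no_pres_le s r _ _) (ncard_repCritParts_no_pres_le s r _ _))

/-- Proposition 5 of the paper: if a senator's critical number vanishes at `k`, so does a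
representative's; and wherever the senator's critical number is nonzero it strictly
exceeds the representative's. -/
theorem us_senator_dominates_representative (s : Fin 100) (r : Fin 435) :
    (∀ k : ℕ, usCrit (USPlayer.sen s) k = 0 → usCrit (USPlayer.rep r) k = 0) ∧
    (∀ k : ℕ, usCrit (USPlayer.sen s) k ≠ 0 →
      usCrit (USPlayer.sen s) k > usCrit (USPlayer.rep r) k) := by
  refine ⟨fun k hk => ?_, fun k hk => ?_⟩
  · by_contra h
    have := usCrit_rep_lt_usCrit_sen (s := s) h
    omega
  · by_cases h : usCrit (USPlayer.rep r) k = 0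
    · omega
    · exact usCrit_rep_lt_usCrit_sen h
end

section
/- Let m_r, m_s, q_r, q_s be natural numbers with m_s < m_r, 1 < q_s < m_s, and 1 < q_r < m_r, and let C denote the binomial coefficient. Suppose a is a natural number with q_r + q_s + 1 ≤ a ≤ min(q_r + m_s, q_s + m_r) such that C(m_s − 1, q_s − 1) · C(m_r, a − q_s) > C(m_r − 1, q_r − 1) · C(m_s, a − q_r). Then for every k with a ≤ k ≤ min(q_r + m_s, q_s + m_r), C(m_s − 1, q_s − 1) · C(m_r, k − q_s) > C(m_r − 1, q_r − 1) · C(m_s, k − q_r). -/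
/-- If `(n + 1) / (v + 1) ≤ (m + 1) / (u + 1)`, then a strict inequality between multiples of
`m.choose u` and `n.choose v` passes to the next pair of binomial coefficients. -/
theorem mul_choose_succ_lt_of_lt {m n u v A B : ℕ} (hu : u < m) (hv : v < n)
    (hD : (n + 1) * (u + 1) ≤ (m + 1) * (v + 1)) (h : B * n.choose v < A * m.choose u) :
    B * n.choose (v + 1) < A * m.choose (u + 1) := by
  obtain ⟨x, rfl⟩ := Nat.exists_eq_add_of_lt hu
  obtain ⟨y, rfl⟩ := Nat.exists_eq_add_of_lt hv
  have e₁ := Nat.choose_succ_right_eq (u + x + 1) u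
  have e₂ := Nat.choose_succ_right_eq (v + y + 1) v
  rw [show u + x + 1 - u = x + 1 by omega] at e₁
  rw [show v + y + 1 - v = y + 1 by omega] at e₂
  have hxy : (y + 1) * (u + 1) ≤ (x + 1) * (v + 1) := by nlinarith
  refine lt_of_mul_lt_mul_right (a := (u + 1) * (v + 1)) ?_ (Nat.zero_le _)
  calc B * (v + y + 1).choose (v + 1) * ((u + 1) * (v + 1))
      = B * (u + 1) * ((v + y + 1).choose (v + 1) * (v + 1)) := by ring
    _ = B * (v + y + 1).choose v * ((y + 1) * (u + 1)) := by rw [e₂]; ring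
    _ < A * (u + x + 1).choose u * ((y + 1) * (u + 1)) := by gcongr
    _ ≤ A * (u + x + 1).choose u * ((x + 1) * (v + 1)) := by gcongr
    _ = A * (v + 1) * ((u + x + 1).choose (u + 1) * (u + 1)) := by rw [e₁]; ring
    _ = A * (u + x + 1).choose (u + 1) * ((u + 1) * (v + 1)) := by ring

/-- If `(m + 1) / (u + 1) ≤ (n + 1) / (v + 1)`, then a weak inequality between multiples of
`m.choose u` and `n.choose v` passes to the next pair of binomial coefficients. -/
theorem mul_choose_succ_le_of_le {m n u v A B : ℕ} (hu : u < m) (hv : v < n)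
    (hD : (m + 1) * (v + 1) ≤ (n + 1) * (u + 1)) (h : A * m.choose u ≤ B * n.choose v) :
    A * m.choose (u + 1) ≤ B * n.choose (v + 1) := by
  by_contra! hlt
  obtain ⟨x, rfl⟩ := Nat.exists_eq_add_of_lt hu
  obtain ⟨y, rfl⟩ := Nat.exists_eq_add_of_lt hv
  have e₁ := Nat.choose_succ_right_eq (u + x + 1) u
  have e₂ := Nat.choose_succ_right_eq (v + y + 1) v
  rw [show u + x + 1 - u = x + 1 by omega] at e₁
  rw [show v + y + 1 - v = y + 1 by omega] at e₂
  have hxy : (x + 1) * (v + 1) ≤ (y + 1) * (u + 1) := by nlinarith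
  refine absurd hlt (not_lt.2 (le_of_mul_le_mul_right (a := (u + 1) * (v + 1)) ?_ (by positivity)))
  calc A * (u + x + 1).choose (u + 1) * ((u + 1) * (v + 1))
      = A * (v + 1) * ((u + x + 1).choose (u + 1) * (u + 1)) := by ring
    _ = A * (u + x + 1).choose u * ((x + 1) * (v + 1)) := by rw [e₁]; ring
    _ ≤ B * (v + y + 1).choose v * ((y + 1) * (u + 1)) := by gcongr
    _ = B * (u + 1) * ((v + y + 1).choose (v + 1) * (v + 1)) := by rw [e₂]; ring
    _ = B * (v + y + 1).choose (v + 1) * ((u + 1) * (v + 1)) := by ring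

/-- At the base point `k = p + q` the comparison is decided by `q / n` versus `p / m`. -/
theorem pred_choose_mul_choose_le {m n p q : ℕ} (hp : 0 < p) (hq : 0 < q) (hm : 0 < m)
    (hn : 0 < n) (h : q * m ≤ p * n) :
    (n - 1).choose (q - 1) * m.choose p ≤ (m - 1).choose (p - 1) * n.choose q := by
  obtain ⟨m, rfl⟩ := Nat.exists_eq_add_of_lt hm
  obtain ⟨n, rfl⟩ := Nat.exists_eq_add_of_lt hn
  obtain ⟨p, rfl⟩ := Nat.exists_eq_add_of_lt hp
  obtain ⟨q, rfl⟩ := Nat.exists_eq_add_of_lt hq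
  simp only [zero_add, Nat.add_sub_cancel] at *
  have e₁ := Nat.add_one_mul_choose_eq m p
  have e₂ := Nat.add_one_mul_choose_eq n q
  refine le_of_mul_le_mul_right (a := (p + 1) * (q + 1)) ?_ (by positivity)
  calc n.choose q * (m + 1).choose (p + 1) * ((p + 1) * (q + 1))
      = n.choose q * (q + 1) * ((m + 1).choose (p + 1) * (p + 1)) := by ring
    _ = n.choose q * m.choose p * ((q + 1) * (m + 1)) := by rw [← e₁]; ring
    _ ≤ n.choose q * m.choose p * ((p + 1) * (n + 1)) := by gcongr
    _ = m.choose p * (p + 1) * ((n + 1) * n.choose q) := by ring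
    _ = m.choose p * (n + 1).choose (q + 1) * ((p + 1) * (q + 1)) := by rw [e₂]; ring


/-- Corollary 1 of the paper: for `m_s < m_r`, `1 < q_s < m_s`, `1 < q_r < m_r`, if the
inequality `C(m_s−1, q_s−1)·C(m_r, k−q_s) > C(m_r−1, q_r−1)·C(m_s, k−q_r)` holds at some
`k = a` with `q_r + q_s + 1 ≤ a ≤ min(q_r + m_s, q_s + m_r)`, then it holds for every
`k` with `a ≤ k ≤ min(q_r + m_s, q_s + m_r)`. -/
theorem choose_prod_ineq_propagates (ms mr qs qr a : ℕ)
    (hsize : ms < mr) (hqs1 : 1 < qs) (hqs2 : qs < ms) (hqr1 : 1 < qr) (hqr2 : qr < mr)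
    (ha1 : qr + qs + 1 ≤ a) (ha2 : a ≤ min (qr + ms) (qs + mr))
    (ha : (ms - 1).choose (qs - 1) * mr.choose (a - qs) >
      (mr - 1).choose (qr - 1) * ms.choose (a - qr)) :
    ∀ k : ℕ, a ≤ k → k ≤ min (qr + ms) (qs + mr) →
      (ms - 1).choose (qs - 1) * mr.choose (k - qs) >
        (mr - 1).choose (qr - 1) * ms.choose (k - qr) := by
  obtain ⟨i, rfl⟩ : ∃ i, a = qr + qs + i := ⟨a - (qr + qs), by omega⟩
  rw [show qr + qs + i - qs = qr + i by omega, show qr + qs + i - qr = qs + i by omega] at ha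
  rw [le_min_iff] at ha2
  have hD : (ms + 1) * (qr + i + 1) ≤ (mr + 1) * (qs + i + 1) := by
    by_contra! hlt
    have hbase : qs * mr ≤ qr * ms := by
      by_contra! hbase
      have hpos : qr + ms ≤ qs + mr := by
        by_contra! hfar
        nlinarith
      nlinarith [Nat.mul_le_mul_right i hsize.le]
    have hle : ∀ j ≤ i, (ms - 1).choose (qs - 1) * mr.choose (qr + j) ≤
        (mr - 1).choose (qr - 1) * ms.choose (qs + j) := by
      intro j
      induction j with
      | zero =>
        exact fun _ => pred_choose_mul_choose_le (by omega) (by omega) (by omega) (by omega) hbase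
      | succ j ih =>
        intro hj
        refine mul_choose_succ_le_of_le (u := qr + j) (v := qs + j) (by omega) (by omega) ?_ (ih (by omega))
        obtain ⟨d, rfl⟩ := Nat.exists_eq_add_of_lt hj
        nlinarith [Nat.mul_le_mul_right (d + 1) hsize.le]
    exact absurd ha (not_lt.2 (hle i le_rfl))
  intro k hak
  induction k, hak using Nat.le_induction with
  | base =>
    intro _
    rwa [show qr + qs + i - qs = qr + i by omega, show qr + qs + i - qr = qs + i by omega]
  | succ k hk ih =>
    intro hk'
    obtain ⟨d, rfl⟩ := Nat.exists_eq_add_of_le hk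
    rw [le_min_iff] at hk'
    have ih := ih (by rw [le_min_iff]; omega)
    rw [show qr + qs + i + d - qs = qr + i + d by omega,
      show qr + qs + i + d - qr = qs + i + d by omega] at ih
    rw [show qr + qs + i + d + 1 - qs = qr + i + d + 1 by omega,
      show qr + qs + i + d + 1 - qr = qs + i + d + 1 by omega]
    refine mul_choose_succ_lt_of_lt (by omega) (by omega) ?_ ih
    nlinarith [Nat.mul_le_mul_right d hsize.le]
end
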